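/- Let σ > 0 and m ≥ 1. In the Gaussian sequence model y_i = θ_i + σ w_i with w_i i.i.d. standard normal and θ ranging over the set Θ_m = {e_1,…,e_m} of standard basis vectors of ℝ^m, the minimax risk over linear estimators of the form θ̂ = A y with A an m×m real matrix, i.e. inf_A max_{θ ∈ Θ_m} E_θ |Ay - θ|², equals mσ²/(1 + mσ²). -/

import Mathlib

open MeasureTheory ProbabilityTheory

/-- The second moment of an affine function of a standard Gaussian vector. -/
theorem integral_affine_sq_pi_gaussianReal {ι : Type*} [Fintype ι] (a : ι → ℝ) (c : ℝ) :
    ∫ w : ι → ℝ, (c + ∑ k, a k * w k) ^ 2 ∂(Measure.pi fun _ : ι => gaussianReal 0 1)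
      = c ^ 2 + ∑ k, a k ^ 2 ∧
    Integrable (fun w : ι → ℝ => (c + ∑ k, a k * w k) ^ 2)
      (Measure.pi fun _ : ι => gaussianReal 0 1) := by
  set μ := Measure.pi fun _ : ι => gaussianReal 0 1
  have hLp (k : ι) : MemLp (fun x : ℝ => a k * x) 2 (gaussianReal 0 1) :=
    (memLp_id_gaussianReal 2).const_mul (a k)
  have hk (k : ι) : MemLp (fun w : ι → ℝ => a k * w k) 2 μ :=
    (hLp k).comp_measurePreserving (measurePreserving_eval (fun _ : ι => gaussianReal 0 1) k)
  have hS : MemLp (fun w : ι → ℝ => ∑ k, a k * w k) 2 μ := memLp_finsetSum _ fun k _ => hk k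
  have hmean : ∫ w : ι → ℝ, ∑ k, a k * w k ∂μ = 0 := by
    rw [integral_finsetSum _ fun k _ => (hk k).integrable (by norm_num)]
    refine Finset.sum_eq_zero fun k _ => ?_
    rw [integral_const_mul, integral_comp_eval (μ := fun _ : ι => gaussianReal 0 1) (i := k)
      (f := fun x : ℝ => x) (by fun_prop),
      integral_id_gaussianReal, mul_zero]
  have hvar : ∫ w : ι → ℝ, (∑ k, a k * w k) ^ 2 ∂μ = ∑ k, a k ^ 2 := by
    have h := variance_sum_pi hLp
    rw [variance_eq_sub (by convert hS; simp)] at h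
    have hone (k : ι) : Var[fun x : ℝ => a k * x; gaussianReal 0 1] = a k ^ 2 := by
      rw [variance_const_mul, variance_fun_id_gaussianReal]
      simp
    simpa [μ, hone, show ∫ w : ι → ℝ, ∑ k, a k * w k ∂Measure.pi (fun _ : ι => gaussianReal 0 1) = 0
      from hmean] using h
  have hS1 := hS.integrable (by norm_num)
  have hexp : (fun w : ι → ℝ => (c + ∑ k, a k * w k) ^ 2) =
      fun w => (c ^ 2 + 2 * c * ∑ k, a k * w k) + (∑ k, a k * w k) ^ 2 := by
    funext w; ring
  have h1 : Integrable (fun w : ι → ℝ => c ^ 2 + 2 * c * ∑ k, a k * w k) μ :=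
    (integrable_const _).add (hS1.const_mul _)
  rw [hexp]
  refine ⟨?_, h1.add hS.integrable_sq⟩
  rw [integral_add h1 hS.integrable_sq, integral_add (integrable_const _) (hS1.const_mul _),
    integral_const_mul, hmean, hvar]
  simp [μ]

/-- The bias-variance decomposition of the risk of a linear estimator. -/
theorem integral_linear_estimator_risk {ι : Type*} [Fintype ι] (A : Matrix ι ι ℝ) (σ : ℝ)
    (θ : ι → ℝ) :
    ∫ w : ι → ℝ, (∑ i, (A.mulVec (fun k => θ k + σ * w k) i - θ i) ^ 2)
        ∂(Measure.pi fun _ : ι => gaussianReal 0 1)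
      = ∑ i, (A.mulVec θ i - θ i) ^ 2 + σ ^ 2 * ∑ i, ∑ k, A i k ^ 2 := by
  have h (w : ι → ℝ) (i : ι) : A.mulVec (fun k => θ k + σ * w k) i - θ i
      = (A.mulVec θ i - θ i) + ∑ k, (σ * A i k) * w k := by
    simp only [Matrix.mulVec, dotProduct, mul_add, Finset.sum_add_distrib]
    have : ∀ k, A i k * (σ * w k) = σ * A i k * w k := fun k => by ring
    simp only [this]
    ring
  simp only [h]
  rw [integral_finsetSum _ fun i _ => (integral_affine_sq_pi_gaussianReal _ _).2]
  simp only [(integral_affine_sq_pi_gaussianReal _ _).1, Finset.sum_add_distrib, mul_pow,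
    Finset.mul_sum]

/-- In the one-sparse Gaussian sequence model `y = θ + σ w`, `w ~ N(0, I_m)`,
with `θ` ranging over the standard basis vectors `e_1, …, e_m` of `ℝ^m`, the minimax
risk over linear estimators `θ̂ = A y` equals `m σ² / (1 + m σ²)`. -/
theorem stmt_5 (m : ℕ) (hm : 1 ≤ m) (σ : ℝ) (hσ : 0 < σ)
    (e : Fin m → Fin m → ℝ) (he : ∀ j i, e j i = if i = j then 1 else 0) :
    ⨅ A : Matrix (Fin m) (Fin m) ℝ, ⨆ j : Fin m,
      ∫ w : Fin m → ℝ,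
        (∑ i, (A.mulVec (fun i' => e j i' + σ * w i') i - e j i) ^ 2)
        ∂(Measure.pi fun _ : Fin m => gaussianReal 0 1)
      = m * σ ^ 2 / (1 + m * σ ^ 2) := by
  have hAe (A : Matrix (Fin m) (Fin m) ℝ) (j i : Fin m) : A.mulVec (e j) i = A i j := by
    simp [Matrix.mulVec, dotProduct, he]
  simp only [integral_linear_estimator_risk, hAe]
  have hm0 : (0 : ℝ) < m := by exact_mod_cast hm
  have hden : (0 : ℝ) < 1 + m * σ ^ 2 := by positivity
  have : Nonempty (Fin m) := ⟨⟨0, hm⟩⟩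
  have hlower (A : Matrix (Fin m) (Fin m) ℝ) : m * σ ^ 2 / (1 + m * σ ^ 2) ≤
      ⨆ j, (∑ i, (A i j - e j i) ^ 2 + σ ^ 2 * ∑ i, ∑ k, A i k ^ 2) := by
    set R := fun j => ∑ i, (A i j - e j i) ^ 2 + σ ^ 2 * ∑ i, ∑ k, A i k ^ 2 with hR
    have hscalar (a : ℝ) :
        m * σ ^ 2 / (1 + m * σ ^ 2) ≤ (a - 1) ^ 2 + m * σ ^ 2 * a ^ 2 := by
      rw [div_le_iff₀ hden]
      nlinarith [sq_nonneg ((1 + m * σ ^ 2) * a - 1)]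
    have hbias (j : Fin m) : (A j j - 1) ^ 2 ≤ ∑ i, (A i j - e j i) ^ 2 := by
      simpa [he] using Finset.single_le_sum (f := fun i => (A i j - e j i) ^ 2)
        (fun i _ => sq_nonneg _) (Finset.mem_univ j)
    have hvar : ∑ j, A j j ^ 2 ≤ ∑ i, ∑ k, A i k ^ 2 :=
      Finset.sum_le_sum fun i _ => Finset.single_le_sum (f := fun k => A i k ^ 2)
        (fun k _ => sq_nonneg _) (Finset.mem_univ i)
    have havg : ∑ _j : Fin m, m * σ ^ 2 / (1 + m * σ ^ 2) ≤ ∑ j, R j := by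
      calc ∑ _j : Fin m, m * σ ^ 2 / (1 + m * σ ^ 2)
          ≤ ∑ j, ((A j j - 1) ^ 2 + m * σ ^ 2 * A j j ^ 2) :=
            Finset.sum_le_sum fun j _ => hscalar _
        _ = ∑ j, (A j j - 1) ^ 2 + m * σ ^ 2 * ∑ j, A j j ^ 2 := by
            rw [Finset.sum_add_distrib, Finset.mul_sum]
        _ ≤ ∑ j, ∑ i, (A i j - e j i) ^ 2 + m * σ ^ 2 * ∑ i, ∑ k, A i k ^ 2 := by
            gcongr with j
            exact hbias j
        _ = ∑ j, R j := by
            simp [hR, Finset.sum_add_distrib, mul_assoc]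
    obtain ⟨j, -, hj⟩ := Finset.exists_le_of_sum_le Finset.univ_nonempty havg
    exact hj.trans (le_ciSup (Set.finite_range R).bddAbove j)
  refine le_antisymm ?_ (le_ciInf hlower)
  refine (ciInf_le ⟨_, Set.forall_mem_range.2 hlower⟩
    (Matrix.diagonal fun _ => 1 / (1 + m * σ ^ 2))).trans (ciSup_le fun j => le_of_eq ?_)
  have hbias : ∑ i, (Matrix.diagonal (fun _ => 1 / (1 + m * σ ^ 2)) i j - e j i) ^ 2
      = (1 / (1 + m * σ ^ 2) - 1) ^ 2 := by
    rw [Finset.sum_eq_single j]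
    · simp [he]
    · intro i _ hij
      simp [he, hij]
    · simp
  have hvar : ∑ i : Fin m, ∑ k, Matrix.diagonal (fun _ : Fin m => 1 / (1 + m * σ ^ 2)) i k ^ 2
      = m * (1 / (1 + m * σ ^ 2)) ^ 2 := by
    simp [Matrix.diagonal_apply, ite_pow]
  rw [hbias, hvar]
  field_simp
  ring
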